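/- Let n, k, r be positive integers with n ≥ 4k²(e·r)^k (where e is Euler's number). Let F_1, F_2, …, F_k be r-graphs on the vertex set [n]. Suppose that for every i ∈ {1, 2, …, k} there exists some s ∈ {r, r+1, …, k+r−2} such that K_s^r(F_i) > K_s^r(F^{(r)}_{n,k−1,1}). Then the family {F_1, F_2, …, F_k} contains a rainbow matching. -/

import Mathlib

open Finset

/-- The number of `s`-cliques of the `r`-uniform hypergraph `H`
(sets of `s` vertices all of whose `r`-element subsets are edges). -/
def cliqueCount {V : Type*} [Fintype V] [DecidableEq V] (r s : ℕ)
    (H : Finset (Finset V)) : ℕ :=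
  ((Finset.univ.powersetCard s).filter (fun S => S.powersetCard r ⊆ H)).card

/-- The hypergraph `F^{(r)}_{n,k,a}` on `Fin n`: all `r`-element subsets having
at least `a` elements among the first `a*k + a - 1` vertices. -/
def Fnka (n k r a : ℕ) : Finset (Finset (Fin n)) :=
  (Finset.univ.powersetCard r).filter
    (fun E => a ≤ (E.filter (fun x : Fin n => (x : ℕ) < a * k + a - 1)).card)

/-- The matching number of `H` is at most `k`. -/
def matchingLE {V : Type*} (H : Finset (Finset V)) (k : ℕ) : Prop :=
  ∀ M ⊆ H, (M : Set (Finset V)).Pairwise Disjoint → M.card ≤ k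

/-- The degree of a vertex set `A`: the number of edges of `H` containing `A`. -/
def degOf {V : Type*} [DecidableEq V] (H : Finset (Finset V)) (A : Finset V) : ℕ :=
  (H.filter (fun E => A ⊆ E)).card

/-- The shifting operator `S_{ij}` applied to a single edge. -/
def shiftEdge {n : ℕ} (H : Finset (Finset (Fin n))) (i j : Fin n)
    (E : Finset (Fin n)) : Finset (Fin n) :=
  if j ∈ E ∧ i ∉ E ∧ insert i (E.erase j) ∉ H then insert i (E.erase j) else E

/-- The shifted hypergraph `S_{ij}(H)`. -/
def shift {n : ℕ} (H : Finset (Finset (Fin n))) (i j : Fin n) :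
    Finset (Finset (Fin n)) :=
  H.image (shiftEdge H i j)

/-- `H` is stable if it is invariant under all shifts `S_{ij}` with `i < j`. -/
def IsStable {n : ℕ} (H : Finset (Finset (Fin n))) : Prop :=
  ∀ i j : Fin n, i < j → shift H i j = H

/-- The number of `r`-element subsets of an `n`-element set containing a fixed set of size `j`. -/
def supersetCount (n r j : ℕ) : ℕ := if j ≤ r then (n - j).choose (r - j) else 0

/-- `e` selects pairwise disjoint edges `e i ∈ F i` for the indices `i ∈ J`. -/
def RainbowOn {V ι : Type*} (F : ι → Finset (Finset V)) (J : Finset ι) (e : ι → Finset V) :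
    Prop :=
  (∀ i ∈ J, e i ∈ F i) ∧ ∀ i ∈ J, ∀ j ∈ J, i ≠ j → Disjoint (e i) (e j)

lemma RainbowOn.insert {V ι : Type*} [DecidableEq ι] {F : ι → Finset (Finset V)} {J : Finset ι}
    {e : ι → Finset V} (he : RainbowOn F J e) {i : ι} (hi : i ∉ J) {E : Finset V} (hE : E ∈ F i)
    (hdisj : ∀ j ∈ J, Disjoint E (e j)) :
    RainbowOn F (insert i J) (Function.update e i E) := by
  have hne : ∀ j ∈ J, j ≠ i := fun j hj h => hi (h ▸ hj)
  refine ⟨?_, ?_⟩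
  · intro j hj
    rcases Finset.mem_insert.1 hj with rfl | hj
    · simpa using hE
    · simpa [Function.update_of_ne (hne j hj)] using he.1 j hj
  · intro a ha b hb hab
    rcases Finset.mem_insert.1 ha with rfl | haJ <;> rcases Finset.mem_insert.1 hb with rfl | hbJ
    · exact absurd rfl hab
    · simpa [Function.update_of_ne (hne b hbJ)] using hdisj b hbJ
    · simpa [Function.update_of_ne (hne a haJ)] using (hdisj a haJ).symm
    · simpa [Function.update_of_ne (hne a haJ), Function.update_of_ne (hne b hbJ)]
        using he.2 a haJ b hbJ hab

lemma RainbowOn.mono {V ι : Type*} {F G : ι → Finset (Finset V)} {J : Finset ι}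
    {e : ι → Finset V} (he : RainbowOn F J e) (h : ∀ i ∈ J, F i ⊆ G i) : RainbowOn G J e :=
  ⟨fun i hi => h i hi (he.1 i hi), he.2⟩

lemma RainbowOn.card_biUnion_le {V ι : Type*} [DecidableEq V] {F : ι → Finset (Finset V)}
    {J : Finset ι} {e : ι → Finset V} {r : ℕ} (he : RainbowOn F J e)
    (hF : ∀ i ∈ J, ∀ E ∈ F i, #E = r) : #(J.biUnion e) ≤ #J * r :=
  Finset.card_biUnion_le_card_mul _ _ _ fun i hi => (hF i hi _ (he.1 i hi)).le

lemma mul_supersetCount_succ {n r j : ℕ} (hj : j < n) :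
    (n - j) * supersetCount n r (j + 1) = (r - j) * supersetCount n r j := by
  unfold supersetCount
  rcases lt_trichotomy j r with h | rfl | h
  · rw [if_pos (by omega), if_pos h.le]
    obtain ⟨a, rfl⟩ : ∃ a, n = j + 1 + a := ⟨n - (j + 1), by omega⟩
    obtain ⟨b, rfl⟩ : ∃ b, r = j + 1 + b := ⟨r - (j + 1), by omega⟩
    have := Nat.add_one_mul_choose_eq a b
    simp only [show j + 1 + a - j = a + 1 by omega, show j + 1 + b - j = b + 1 by omega,
      Nat.add_sub_cancel_left]
    rw [this, mul_comm]
  · simp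
  · rw [if_neg (by omega), if_neg (by omega)]; simp

lemma degOf_le_supersetCount {n r : ℕ} {H : Finset (Finset (Fin n))} (hH : ∀ E ∈ H, #E = r)
    (A : Finset (Fin n)) : degOf H A ≤ supersetCount n r #A := by
  unfold degOf supersetCount
  split_ifs with h
  · calc #(H.filter fun E => A ⊆ E) ≤ #(Aᶜ.powersetCard (r - #A)) := by
          refine Finset.card_le_card_of_injOn (fun E => E \ A) ?_ ?_
          · intro E hE
            simp only [Finset.mem_coe, Finset.mem_filter] at hE
            simp only [Finset.mem_coe, Finset.mem_powersetCard]
            exact ⟨fun x hx => by simp_all, by rw [Finset.card_sdiff_of_subset hE.2, hH E hE.1]⟩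
          · intro E hE E' hE' heq
            simp only [Finset.mem_coe, Finset.mem_filter] at hE hE'
            rw [← Finset.sdiff_union_of_subset hE.2, ← Finset.sdiff_union_of_subset hE'.2]
            exact congrArg (· ∪ A) heq
    _ = (n - #A).choose (r - #A) := by
          rw [Finset.card_powersetCard, Finset.card_compl, Fintype.card_fin]
  · simp only [Nat.le_zero, Finset.card_eq_zero, Finset.filter_eq_empty_iff]
    intro E hE hAE
    exact h (hH E hE ▸ Finset.card_le_card hAE)

/-- Families of edges rooted at distinct vertices have a rainbow matching as soon as each of them
is larger than a linear multiple of the number of `r`-sets through two points. -/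
lemma exists_rainbowOn_of_rooted {ι : Type*} [DecidableEq ι] {n r k : ℕ}
    (h32 : k * r ^ 2 * supersetCount n r 3 ≤ supersetCount n r 2) (x : ι → Fin n) (m : ℕ) :
    m ≤ k → ∀ (J : Finset ι) (G : ι → Finset (Finset (Fin n))), #J = m →
    (∀ i ∈ J, ∀ E ∈ G i, #E = r) → (∀ i ∈ J, ∀ E ∈ G i, x i ∈ E) →
    (∀ i ∈ J, ∀ E ∈ G i, ∀ j ∈ J, j ≠ i → x j ∉ E) →
    (∀ i ∈ J, m * supersetCount n r 2 < #(G i) + supersetCount n r 2) →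
    ∃ e, RainbowOn G J e := by
  induction m with
  | zero =>
    intro _ J G hJ _ _ _ _
    rw [Finset.card_eq_zero] at hJ
    subst hJ
    exact ⟨fun _ => ∅, by simp [RainbowOn]⟩
  | succ m ih =>
    intro hmk J G hJ hr hx hx' hG
    have hcardE : ∀ i ∈ J, #(J.erase i) = m := fun i hi => by
      rw [Finset.card_erase_of_mem hi, hJ]; rfl
    by_cases hA : ∃ i ∈ J, ∃ v, ∀ T : Finset (Fin n), #T ≤ m * r → v ∉ T → x i ∉ T →
        ∃ E ∈ G i, v ∈ E ∧ Disjoint E T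
    · obtain ⟨i, hi, v, hv⟩ := hA
      have hvx : ∀ j ∈ J, j ≠ i → x j ≠ v := by
        rintro j hj hji rfl
        obtain ⟨E, hE, hvE, -⟩ := hv ∅ (by simp) (by simp) (by simp)
        exact hx' i hi E hE j hj hji hvE
      have hsub : ∀ j, (G j).filter (fun E => v ∉ E) ⊆ G j := fun j => Finset.filter_subset _ _
      obtain ⟨e, he⟩ := ih (by omega) (J.erase i) (fun j => (G j).filter fun E => v ∉ E)
        (hcardE i hi)
        (fun j hj E hE => hr j (Finset.mem_of_mem_erase hj) E (hsub j hE))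
        (fun j hj E hE => hx j (Finset.mem_of_mem_erase hj) E (hsub j hE))
        (fun j hj E hE l hl hlj => hx' j (Finset.mem_of_mem_erase hj) E (hsub j hE) l
          (Finset.mem_of_mem_erase hl) hlj) (by
          intro j hj
          obtain ⟨hji, hj⟩ := Finset.mem_erase.1 hj
          have h1 := hG j hj
          have h2 : #((G j).filter fun E => v ∈ E) ≤ supersetCount n r 2 := by
            rw [← Finset.card_pair (hvx j hj hji)]
            refine le_trans (Finset.card_le_card fun E hE => ?_)
              (degOf_le_supersetCount (hr j hj) {x j, v})
            simp only [Finset.mem_filter] at hE ⊢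
            refine ⟨hE.1, ?_⟩
            simp [Finset.insert_subset_iff, hE.2, hx j hj E hE.1]
          have h3 := Finset.card_filter_add_card_filter_not (s := G j) (fun E => v ∈ E)
          rw [add_mul] at h1
          omega)
      have heG := he.mono fun j _ => hsub j
      obtain ⟨E, hE, -, hdisj⟩ := hv ((J.erase i).biUnion e)
        ((heG.card_biUnion_le fun j hj => hr j (Finset.mem_of_mem_erase hj)).trans
          (by rw [hcardE i hi]))
        (by
          simp only [Finset.mem_biUnion, not_exists, not_and]
          exact fun j hj => (Finset.mem_filter.1 (he.1 j hj)).2)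
        (by
          simp only [Finset.mem_biUnion, not_exists, not_and]
          exact fun j hj => hx' j (Finset.mem_of_mem_erase hj) _ (heG.1 j hj) i hi
            (Finset.ne_of_mem_erase hj).symm)
      refine ⟨_, Finset.insert_erase hi ▸ heG.insert (Finset.notMem_erase i J) hE fun j hj => ?_⟩
      exact (Finset.disjoint_biUnion_right _ _ _).1 hdisj j hj
    · by_cases hB : ∃ i ∈ J, ∀ U : Finset (Fin n), #U ≤ m * r → x i ∉ U →
          ∃ E ∈ G i, Disjoint E U
      · obtain ⟨i, hi, hU⟩ := hB
        obtain ⟨e, he⟩ := ih (by omega) (J.erase i) G (hcardE i hi)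
          (fun j hj => hr j (Finset.mem_of_mem_erase hj))
          (fun j hj => hx j (Finset.mem_of_mem_erase hj))
          (fun j hj E hE l hl hlj => hx' j (Finset.mem_of_mem_erase hj) E hE l
            (Finset.mem_of_mem_erase hl) hlj)
          (fun j hj => by
            have := hG j (Finset.mem_of_mem_erase hj)
            rw [add_mul] at this
            omega)
        obtain ⟨E, hE, hdisj⟩ := hU ((J.erase i).biUnion e)
          ((he.card_biUnion_le fun j hj => hr j (Finset.mem_of_mem_erase hj)).trans
            (by rw [hcardE i hi]))
          (by
            simp only [Finset.mem_biUnion, not_exists, not_and]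
            exact fun j hj => hx' j (Finset.mem_of_mem_erase hj) _ (he.1 j hj) i hi
              (Finset.ne_of_mem_erase hj).symm)
        refine ⟨_, Finset.insert_erase hi ▸ he.insert (Finset.notMem_erase i J) hE fun j hj => ?_⟩
        exact (Finset.disjoint_biUnion_right _ _ _).1 hdisj j hj
      · exfalso
        push Not at hA hB
        obtain ⟨i, hi⟩ : J.Nonempty := Finset.card_pos.1 (by omega)
        obtain ⟨U, hUc, hUx, hU⟩ := hB i hi
        choose T hTc hTv hTx hT using hA i hi
        have hsub : G i ⊆ U.biUnion fun v => (T v).biUnion fun w =>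
            (G i).filter fun E => {x i, v, w} ⊆ E := by
          intro E hE
          obtain ⟨v, hvE, hvU⟩ := Finset.not_disjoint_iff.1 (hU E hE)
          obtain ⟨w, hwE, hwT⟩ := Finset.not_disjoint_iff.1 (hT v E hE hvE)
          simp only [Finset.mem_biUnion, Finset.mem_filter]
          refine ⟨v, hvU, w, hwT, hE, ?_⟩
          simp [Finset.insert_subset_iff, hvE, hwE, hx i hi E hE]
        have hcard : #(G i) ≤ #U * (m * r * supersetCount n r 3) := by
          refine (Finset.card_le_card hsub).trans
            (Finset.card_biUnion_le_card_mul _ _ _ fun v hv => ?_)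
          refine (Finset.card_biUnion_le_card_mul _ _ (supersetCount n r 3) fun w hw => ?_).trans
            (Nat.mul_le_mul_right _ (hTc v))
          have h3 : #({x i, v, w} : Finset (Fin n)) = 3 := by
            rw [Finset.card_eq_three]
            exact ⟨x i, v, w, fun h => hUx (h ▸ hv), fun h => hTx v (h ▸ hw),
              fun h => hTv v (h ▸ hw), rfl⟩
          rw [← h3]
          exact degOf_le_supersetCount (hr i hi) _
        have hGi := hG i hi
        have h1 : #U * (m * r * supersetCount n r 3) ≤ m * supersetCount n r 2 :=
          calc #U * (m * r * supersetCount n r 3)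
              ≤ m * r * (m * r * supersetCount n r 3) := Nat.mul_le_mul_right _ hUc
            _ = m * (m * r ^ 2 * supersetCount n r 3) := by ring
            _ ≤ m * (k * r ^ 2 * supersetCount n r 3) := by gcongr; omega
            _ ≤ m * supersetCount n r 2 := by gcongr
        rw [add_mul] at hGi
        omega

/-- Distinct vertices of large degree, avoiding a set `W`, can be completed to a rainbow matching
avoiding `W`. -/
lemma exists_rainbowOn_of_degree {ι : Type*} [DecidableEq ι] {n r k : ℕ}
    (h32 : k * r ^ 2 * supersetCount n r 3 ≤ supersetCount n r 2) {J : Finset ι} (hJ : #J ≤ k)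
    {F : ι → Finset (Finset (Fin n))} (hF : ∀ i ∈ J, ∀ E ∈ F i, #E = r) {x : ι → Fin n}
    (hx : Set.InjOn x J) {W : Finset (Fin n)} (hxW : ∀ i ∈ J, x i ∉ W)
    (hdeg : ∀ i ∈ J, (2 * k + #W) * supersetCount n r 2 < degOf (F i) {x i}) :
    ∃ e, RainbowOn F J e ∧ ∀ i ∈ J, Disjoint (e i) W := by
  set Y : ι → Finset (Fin n) := fun i => (J.image x).erase (x i) ∪ W with hY
  set G : ι → Finset (Finset (Fin n)) := fun i =>
    (F i).filter fun E => x i ∈ E ∧ Disjoint E (Y i) with hGdef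
  have hGF : ∀ i ∈ J, G i ⊆ F i := fun i _ => Finset.filter_subset _ _
  obtain ⟨e, he⟩ := exists_rainbowOn_of_rooted h32 x #J hJ J G rfl
    (fun i hi E hE => hF i hi E (hGF i hi hE))
    (fun i _ E hE => (Finset.mem_filter.1 hE).2.1)
    (fun i hi E hE j hj hji hjE => by
      refine Finset.disjoint_left.1 (Finset.mem_filter.1 hE).2.2 hjE ?_
      refine Finset.mem_union_left _ (Finset.mem_erase.2 ⟨fun h => hji (hx hj hi h), ?_⟩)
      exact Finset.mem_image_of_mem x hj)
    (by
      intro i hi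
      have hxY : x i ∉ Y i := by simp [hY, hxW i hi]
      have hYc : #(Y i) ≤ k + #W :=
        (Finset.card_union_le _ _).trans (Nat.add_le_add_right
          ((Finset.card_erase_le.trans Finset.card_image_le).trans hJ) _)
      have hsub : (F i).filter (fun E => {x i} ⊆ E) ⊆
          G i ∪ (Y i).biUnion fun y => (F i).filter fun E => {x i, y} ⊆ E := by
        intro E hE
        simp only [Finset.mem_filter, Finset.singleton_subset_iff] at hE
        by_cases hd : Disjoint E (Y i)
        · exact Finset.mem_union_left _ (Finset.mem_filter.2 ⟨hE.1, hE.2, hd⟩)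
        · obtain ⟨y, hyE, hyY⟩ := Finset.not_disjoint_iff.1 hd
          refine Finset.mem_union_right _ (Finset.mem_biUnion.2 ⟨y, hyY, ?_⟩)
          simp [Finset.insert_subset_iff, hE, hyE]
      have hcard : degOf (F i) {x i} ≤ #(G i) + #(Y i) * supersetCount n r 2 := by
        refine (Finset.card_le_card hsub).trans ((Finset.card_union_le _ _).trans
          (Nat.add_le_add_left (Finset.card_biUnion_le_card_mul _ _ _ fun y hy => ?_) _))
        rw [← Finset.card_pair (a := x i) (b := y) fun h => hxY (h ▸ hy)]
        exact degOf_le_supersetCount (hF i hi) _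
      have h1 := Nat.mul_le_mul_right (supersetCount n r 2) hYc
      have h2 := Nat.mul_le_mul_right (supersetCount n r 2) hJ
      have h3 := hdeg i hi
      have h4 : (2 * k + #W) * supersetCount n r 2 =
          (k + #W) * supersetCount n r 2 + k * supersetCount n r 2 := by ring
      omega)
  refine ⟨e, he.mono hGF, fun i hi => ?_⟩
  exact Finset.disjoint_of_subset_right Finset.subset_union_right
    (Finset.mem_filter.1 (he.1 i hi)).2.2

/-- Cross-intersecting version of the Erdős–Ko–Rado theorem. -/
lemma exists_disjoint_of_choose_lt_card {n r : ℕ} {𝒜 ℬ : Finset (Finset (Fin n))} (hr : 0 < r)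
    (hn : 2 * r ≤ n) (h𝒜 : ∀ E ∈ 𝒜, #E = r) (hℬ : ∀ E ∈ ℬ, #E = r)
    (h𝒜c : (n - 1).choose (r - 1) < #𝒜) (hℬc : (n - 1).choose (r - 1) < #ℬ) :
    ∃ A ∈ 𝒜, ∃ B ∈ ℬ, Disjoint A B := by
  by_contra! hcross
  have hdisj : Disjoint ℬ (Finset.shadow^[n - 2 * r] 𝒜.compls) :=
    Finset.disjoint_right.2 fun B hBbar hB => by
      simp only [Finset.mem_shadow_iterate_iff_exists_sdiff, Finset.mem_compls] at hBbar
      obtain ⟨C, hC, hBC, -⟩ := hBbar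
      exact hcross _ hC B hB
        (Finset.disjoint_of_subset_right hBC disjoint_compl_left)
  have hsized : ((𝒜.compls : Finset (Finset (Fin n))) : Set (Finset (Fin n))).Sized (n - r) := by
    have : (𝒜 : Set (Finset (Fin n))).Sized r := fun E hE => h𝒜 E hE
    simpa using this.compls
  have hz : (n - 1).choose (n - r) ≤ #𝒜.compls := by
    rw [Finset.card_compls, Nat.choose_symm_of_eq_add (b := r - 1) (by omega)]
    exact h𝒜c.le
  have kk := Finset.kruskal_katona_lovasz_form (i := n - 2 * r) (by omega)
    (show n - r ≤ n - 1 by omega) tsub_le_self hsized hz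
  rw [show n - r - (n - 2 * r) = r by omega] at kk
  have hlt : n.choose r < #(ℬ ∪ Finset.shadow^[n - 2 * r] 𝒜.compls) := by
    rw [Finset.card_union_of_disjoint hdisj]
    obtain ⟨a, rfl⟩ : ∃ a, n = a + 1 := ⟨n - 1, by omega⟩
    obtain ⟨b, rfl⟩ : ∃ b, r = b + 1 := ⟨r - 1, by omega⟩
    rw [Nat.choose_succ_succ']
    simp only [Nat.add_sub_cancel] at *
    omega
  refine hlt.not_ge ?_
  have hall : ((ℬ ∪ Finset.shadow^[n - 2 * r] 𝒜.compls : Finset (Finset (Fin n))) :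
      Set (Finset (Fin n))).Sized r := by
    rw [Finset.coe_union, Set.sized_union]
    refine ⟨fun E hE => hℬ E hE, ?_⟩
    have := hsized.shadow_iterate (k := n - 2 * r)
    rwa [show n - r - (n - 2 * r) = r by omega] at this
  simpa using hall.card_le

lemma pow_le_pow_mul_choose {m t : ℕ} (h : t ≤ m) : m ^ t ≤ t ^ t * m.choose t := by
  induction t generalizing m with
  | zero => simp
  | succ t ih =>
    obtain ⟨m, rfl⟩ : ∃ a, m = a + 1 := ⟨m - 1, by omega⟩
    have hle : t ≤ m := by omega
    rcases Nat.eq_zero_or_pos t with rfl | ht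
    · simp
    have h1 := ih hle
    have h2 := Nat.add_one_mul_choose_eq m t
    have h3 : t * (m + 1) ≤ m * (t + 1) := by nlinarith
    have h4 : t ^ t * (m + 1) ^ t ≤ t ^ t * ((t + 1) ^ t * m.choose t) :=
      calc t ^ t * (m + 1) ^ t = (t * (m + 1)) ^ t := (mul_pow _ _ _).symm
        _ ≤ (m * (t + 1)) ^ t := Nat.pow_le_pow_left h3 t
        _ = m ^ t * (t + 1) ^ t := mul_pow _ _ _
        _ ≤ (t ^ t * m.choose t) * (t + 1) ^ t := Nat.mul_le_mul_right _ h1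
        _ = _ := by ring
    have h5 := Nat.le_of_mul_le_mul_left h4 (pow_pos ht t)
    calc (m + 1) ^ (t + 1) = (m + 1) * (m + 1) ^ t := pow_succ' _ _
      _ ≤ (m + 1) * ((t + 1) ^ t * m.choose t) := Nat.mul_le_mul_left _ h5
      _ = (t + 1) ^ t * ((m + 1) * m.choose t) := by ring
      _ = (t + 1) ^ (t + 1) * (m + 1).choose (t + 1) := by rw [h2]; ring

lemma choose_mul_le_exp_mul_pow_mul_choose {m r t : ℕ} (h : t ≤ m) :
    ((m * r).choose t : ℝ) ≤ (Real.exp 1 * r) ^ t * m.choose t := by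
  have h1 : ((m * r).choose t : ℝ) ≤ ((m * r : ℕ) : ℝ) ^ t / t.factorial :=
    Nat.choose_le_pow_div _ _
  have h2 : (t : ℝ) ^ t / t.factorial ≤ Real.exp 1 ^ t := by
    rw [← Real.exp_nat_mul, mul_one]
    exact Real.pow_div_factorial_le_exp _ (Nat.cast_nonneg t) t
  have h3 : (m : ℝ) ^ t ≤ (t : ℝ) ^ t * m.choose t := by exact_mod_cast pow_le_pow_mul_choose h
  calc ((m * r).choose t : ℝ) ≤ ((m * r : ℕ) : ℝ) ^ t / t.factorial := h1
    _ = (m : ℝ) ^ t * ((r : ℝ) ^ t / t.factorial) := by push_cast; ring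
    _ ≤ ((t : ℝ) ^ t * m.choose t) * ((r : ℝ) ^ t / t.factorial) := by gcongr
    _ = ((t : ℝ) ^ t / t.factorial) * ((r : ℝ) ^ t * m.choose t) := by ring
    _ ≤ Real.exp 1 ^ t * ((r : ℝ) ^ t * m.choose t) := by gcongr
    _ = _ := by ring

lemma choose_le_choose_add_mul_supersetCount {n r : ℕ} (hr : 0 < r) (m : ℕ) (hm : m + 1 ≤ n) :
    (n - 1).choose (r - 1) ≤ (n - (m + 1)).choose (r - 1) + m * supersetCount n r 2 := by
  induction m with
  | zero => simp
  | succ m ih =>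
    refine (ih (by omega)).trans ?_
    have h : (n - (m + 1)).choose (r - 1) ≤
        (n - (m + 1 + 1)).choose (r - 1) + supersetCount n r 2 := by
      unfold supersetCount
      rcases Nat.lt_or_ge r 2 with h2 | h2
      · obtain rfl : r = 1 := by omega
        simp
      · rw [if_pos h2, show n - (m + 1) = n - (m + 1 + 1) + 1 by omega,
          show r - 1 = r - 2 + 1 by omega, Nat.choose_succ_succ']
        have := Nat.choose_le_choose (r - 2) (show n - (m + 1 + 1) ≤ n - 2 by omega)
        omega
    rw [add_mul, one_mul]
    omega

/-- The number of `s`-sets meeting `Z` in at least `t` points depends only on the size of `Z`. -/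
lemma card_filter_inter_eq_of_card_eq {n : ℕ} (s t : ℕ) {Y Z : Finset (Fin n)} (h : #Y = #Z) :
    #((Finset.univ.powersetCard s).filter fun S => t ≤ #(S ∩ Y)) =
      #((Finset.univ.powersetCard s).filter fun S => t ≤ #(S ∩ Z)) := by
  have key : ∀ Y Z : Finset (Fin n), #Y = #Z →
      #((Finset.univ.powersetCard s).filter fun S => t ≤ #(S ∩ Y)) ≤
      #((Finset.univ.powersetCard s).filter fun S => t ≤ #(S ∩ Z)) := by
    intro Y Z h
    let σ : Equiv.Perm (Fin n) := (Finset.equivOfCardEq h).extendSubtype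
    have hσ : Y.map σ.toEmbedding = Z := by
      refine Finset.eq_of_subset_of_card_le (fun z hz => ?_) (by simp [h])
      obtain ⟨y, hy, rfl⟩ := Finset.mem_map.1 hz
      exact (Finset.equivOfCardEq h).extendSubtype_mem y hy
    refine Finset.card_le_card_of_injOn (fun S => S.map σ.toEmbedding) ?_
      ((Finset.map_injective _).injOn)
    intro S hS
    simp only [Finset.mem_coe, Finset.mem_filter, Finset.mem_powersetCard_univ] at hS ⊢
    rw [← hσ, ← Finset.map_inter]
    simpa using hS
  exact (key Y Z h).antisymm (key Z Y h.symm)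

/-- Every `s`-set with at most `r - 1` points outside `[k]` is a clique of `F^{(r)}_{n,k,1}`. -/
lemma card_filter_inter_le_cliqueCount {n k r s : ℕ} (hrs : r ≤ s) :
    #((Finset.univ.powersetCard s).filter fun S : Finset (Fin n) =>
      s - r + 1 ≤ #(S ∩ Finset.univ.filter fun x : Fin n => (x : ℕ) < k)) ≤
      cliqueCount r s (Fnka n k r 1) := by
  unfold cliqueCount Fnka
  refine Finset.card_le_card fun S hS => ?_
  simp only [Finset.mem_filter, Finset.mem_powersetCard_univ] at hS ⊢
  refine ⟨hS.1, fun E hE => ?_⟩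
  obtain ⟨hES, hEr⟩ := Finset.mem_powersetCard.1 hE
  simp only [Finset.mem_filter, Finset.mem_powersetCard_univ]
  refine ⟨hEr, ?_⟩
  rw [Finset.one_le_card]
  by_contra hne
  rw [Finset.not_nonempty_iff_eq_empty, Finset.filter_eq_empty_iff] at hne
  have hsub : E ⊆ S \ (S ∩ Finset.univ.filter fun x : Fin n => (x : ℕ) < k) := by
    intro x hx
    have := hne hx
    simp only [Finset.mem_sdiff, Finset.mem_inter, Finset.mem_filter, Finset.mem_univ, true_and]
    exact ⟨hES hx, fun h => this (by omega)⟩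
  have h1 := Finset.card_le_card hsub
  have h2 := Finset.card_le_card
    (Finset.inter_subset_left (s₁ := S) (s₂ := Finset.univ.filter fun x : Fin n => (x : ℕ) < k))
  rw [Finset.card_sdiff_of_subset Finset.inter_subset_left] at h1
  omega

lemma card_filter_inter_erase_add_le {n p r : ℕ} (hr : 0 < r) {Z : Finset (Fin n)} {v : Fin n}
    (hv : v ∈ Z) :
    #((Finset.univ.powersetCard (p + r)).filter fun S => p + 1 ≤ #(S ∩ Z.erase v)) +
      (#Z - 1).choose p * (n - #Z).choose (r - 1) ≤
      #((Finset.univ.powersetCard (p + r)).filter fun S => p + 1 ≤ #(S ∩ Z)) := by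
  set I := ((Z.erase v).powersetCard p ×ˢ Zᶜ.powersetCard (r - 1)).image
    (fun x => insert v (x.1 ∪ x.2)) with hI
  have hinter : ∀ Q ⊆ Z.erase v, ∀ R ⊆ Zᶜ, insert v (Q ∪ R) ∩ Z.erase v = Q := by
    intro Q hQ R hR
    ext y
    have h1 : y ∈ Q → y ∈ Z.erase v := fun h => hQ h
    have h2 : y ∈ R → y ∈ Zᶜ := fun h => hR h
    simp only [Finset.mem_inter, Finset.mem_insert, Finset.mem_union, Finset.mem_erase,
      Finset.mem_compl] at *
    tauto
  have hsdiff : ∀ Q ⊆ Z.erase v, ∀ R ⊆ Zᶜ, insert v (Q ∪ R) \ Z = R := by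
    intro Q hQ R hR
    ext y
    have h1 : y ∈ Q → y ∈ Z.erase v := fun h => hQ h
    have h2 : y ∈ R → y ∈ Zᶜ := fun h => hR h
    have h3 : y = v → y ∈ Z := fun h => h ▸ hv
    simp only [Finset.mem_sdiff, Finset.mem_insert, Finset.mem_union, Finset.mem_erase,
      Finset.mem_compl] at *
    tauto
  have hIcard : #I = (#Z - 1).choose p * (n - #Z).choose (r - 1) := by
    rw [hI, Finset.card_image_of_injOn, Finset.card_product, Finset.card_powersetCard,
      Finset.card_powersetCard, Finset.card_erase_of_mem hv, Finset.card_compl, Fintype.card_fin]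
    rintro ⟨Q, R⟩ h ⟨Q', R'⟩ h' heq
    simp only [Finset.mem_coe, Finset.mem_product, Finset.mem_powersetCard] at h h' heq
    have e1 := hinter Q h.1.1 R h.2.1
    have e2 := hsdiff Q h.1.1 R h.2.1
    rw [heq, hinter Q' h'.1.1 R' h'.2.1] at e1
    rw [heq, hsdiff Q' h'.1.1 R' h'.2.1] at e2
    rw [e1, e2]
  rw [← hIcard, ← Finset.card_union_of_disjoint]
  · refine Finset.card_le_card (Finset.union_subset ?_ ?_)
    · refine Finset.monotone_filter_right _ fun S _ hS => ?_
      exact hS.trans (Finset.card_le_card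
        (Finset.inter_subset_inter_left (Finset.erase_subset _ _)))
    · intro S hS
      obtain ⟨⟨Q, R⟩, h, rfl⟩ := Finset.mem_image.1 hS
      simp only [Finset.mem_product, Finset.mem_powersetCard] at h
      have hvQ : v ∉ Q := fun hh => Finset.notMem_erase v Z (h.1.1 hh)
      have hvR : v ∉ R := fun hh => Finset.mem_compl.1 (h.2.1 hh) hv
      have hQR : Disjoint Q R := Finset.disjoint_left.2 fun y hy hy' =>
        Finset.mem_compl.1 (h.2.1 hy') (Finset.mem_of_mem_erase (h.1.1 hy))
      simp only [Finset.mem_filter, Finset.mem_powersetCard_univ]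
      refine ⟨?_, ?_⟩
      · rw [Finset.card_insert_of_notMem (by simp [hvQ, hvR]), Finset.card_union_of_disjoint hQR,
          h.1.2, h.2.2]
        omega
      · rw [← h.1.2, ← Finset.card_insert_of_notMem hvQ]
        refine Finset.card_le_card fun y hy => ?_
        rcases Finset.mem_insert.1 hy with rfl | hy
        · simp [hv]
        · simp [hy, Finset.mem_of_mem_erase (h.1.1 hy)]
  · refine Finset.disjoint_left.2 fun S hS hSI => ?_
    obtain ⟨⟨Q, R⟩, h, rfl⟩ := Finset.mem_image.1 hSI
    simp only [Finset.mem_product, Finset.mem_powersetCard] at h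
    have := (Finset.mem_filter.1 hS).2
    rw [hinter Q h.1.1 R h.2.1, h.1.2] at this
    omega

/-- Upper bound for the number of cliques of a hypergraph whose edges all meet a small set `U`. -/
lemma cliqueCount_le_of_cover {n p r u D : ℕ} (hr : 0 < r) {F : Finset (Finset (Fin n))}
    {U Z : Finset (Fin n)} {v : Fin n} (hv : v ∈ Z) (hU : ∀ E ∈ F, ¬ Disjoint E U) (hUc : #U ≤ u)
    (hD : ∀ w ∉ Z, degOf F {w} ≤ D) :
    cliqueCount r (p + r) F ≤
      #((Finset.univ.powersetCard (p + r)).filter fun S => p + 1 ≤ #(S ∩ Z.erase v)) +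
      (#Z - 1).choose p * degOf F {v} + u.choose (p + 1) * D := by
  classical
  set I := ((Z.erase v).powersetCard p ×ˢ F.filter fun E => {v} ⊆ E).image
    (fun x => x.1 ∪ x.2) with hI
  have hw : ∀ P : Finset (Fin n), ∃ w, ¬ P ⊆ Z → w ∈ P ∧ w ∉ Z := by
    intro P
    by_cases h : P ⊆ Z
    · exact ⟨v, fun h' => absurd h h'⟩
    · obtain ⟨w, hw⟩ := Finset.not_subset.1 h
      exact ⟨w, fun _ => hw⟩
  choose w hw using hw
  set L := ((U.powersetCard (p + 1)).filter fun P => ¬ P ⊆ Z).biUnion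
    (fun P => (F.filter fun E => {w P} ⊆ E).image fun E => P ∪ E) with hL
  have hIcard : #I ≤ (#Z - 1).choose p * degOf F {v} := by
    refine Finset.card_image_le.trans ?_
    rw [Finset.card_product, Finset.card_powersetCard, Finset.card_erase_of_mem hv]
    rfl
  have hLcard : #L ≤ u.choose (p + 1) * D := by
    refine (Finset.card_biUnion_le_card_mul _ _ D fun P hP => ?_).trans
      (Nat.mul_le_mul_right _ ?_)
    · exact Finset.card_image_le.trans (hD _ (hw P (Finset.mem_filter.1 hP).2).2)
    · refine (Finset.card_filter_le _ _).trans ?_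
      rw [Finset.card_powersetCard]
      exact Nat.choose_le_choose _ hUc
  unfold cliqueCount
  refine le_trans (Finset.card_le_card (t := _ ∪ I ∪ L) fun S hS => ?_)
    ((Finset.card_union_le _ _).trans
      (Nat.add_le_add ((Finset.card_union_le _ _).trans (Nat.add_le_add_left hIcard _)) hLcard))
  simp only [Finset.mem_filter, Finset.mem_powersetCard_univ] at hS
  obtain ⟨hSc, hSF⟩ := hS
  have hedge : ∀ E ⊆ S, #E = r → E ∈ F := fun E h1 h2 =>
    hSF (Finset.mem_powersetCard.2 ⟨h1, h2⟩)
  -- removing `p + 1` points of a clique and putting back one of them leaves an edge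
  have hexch : ∀ P ⊆ S, #P = p + 1 → ∀ y ∈ P,
      insert y (S \ P) ∈ F.filter (fun E => {y} ⊆ E) := by
    intro P hPS hPc y hy
    refine Finset.mem_filter.2 ⟨hedge _ ?_ ?_, by simp⟩
    · exact Finset.insert_subset (hPS hy) Finset.sdiff_subset
    · rw [Finset.card_insert_of_notMem (by simp [hy]), Finset.card_sdiff_of_subset hPS, hSc, hPc]
      omega
  by_cases h1 : p + 1 ≤ #(S ∩ Z.erase v)
  · refine Finset.mem_union_left _ (Finset.mem_union_left _ ?_)
    exact Finset.mem_filter.2 ⟨Finset.mem_powersetCard_univ.2 hSc, h1⟩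
  have hUS : p + 1 ≤ #(S ∩ U) := by
    by_contra hlt
    have h3 : r ≤ #(S \ U) := by
      have := Finset.card_sdiff_add_card_inter S U
      omega
    obtain ⟨E, hES, hEc⟩ := Finset.exists_subset_card_eq h3
    exact hU E (hedge E (hES.trans Finset.sdiff_subset) hEc)
      (Finset.disjoint_of_subset_left hES Finset.sdiff_disjoint)
  by_cases h2 : S ∩ U ⊆ Z
  · have hSZ : p + 1 ≤ #(S ∩ Z) := hUS.trans (Finset.card_le_card
      (Finset.subset_inter Finset.inter_subset_left h2))
    have herase : S ∩ Z.erase v = (S ∩ Z).erase v := Finset.inter_erase v S Z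
    have hvS : v ∈ S ∩ Z := by
      by_contra hvS
      rw [herase, Finset.erase_eq_of_notMem hvS] at h1
      exact h1 hSZ
    have hcard := Finset.card_erase_add_one hvS
    rw [← herase] at hcard
    refine Finset.mem_union_left _ (Finset.mem_union_right _ ?_)
    refine Finset.mem_image.2 ⟨(S ∩ Z.erase v, insert v (S \ (S ∩ Z))), ?_, ?_⟩
    · refine Finset.mem_product.2 ⟨Finset.mem_powersetCard.2 ⟨Finset.inter_subset_right, ?_⟩, ?_⟩
      · show #(S ∩ Z.erase v) = p
        omega
      · exact hexch _ Finset.inter_subset_left (by omega) v hvS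
    · ext y
      have : y = v → y ∈ S := fun h => h ▸ (Finset.mem_inter.1 hvS).1
      simp only [Finset.mem_union, Finset.mem_inter, Finset.mem_erase, Finset.mem_insert,
        Finset.mem_sdiff]
      tauto
  · obtain ⟨y, hyS, hyZ⟩ := Finset.not_subset.1 h2
    obtain ⟨P, hyP, hPU, hPc⟩ := Finset.exists_subsuperset_card_eq
      (Finset.singleton_subset_iff.2 hyS) (by simp) hUS
    have hPZ : ¬ P ⊆ Z := fun h => hyZ (h (Finset.singleton_subset_iff.1 hyP))
    have hPS : P ⊆ S := hPU.trans Finset.inter_subset_left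
    refine Finset.mem_union_right _ (Finset.mem_biUnion.2 ⟨P, ?_, ?_⟩)
    · exact Finset.mem_filter.2
        ⟨Finset.mem_powersetCard.2 ⟨hPU.trans Finset.inter_subset_right, hPc⟩, hPZ⟩
    · refine Finset.mem_image.2 ⟨_, hexch P hPS hPc (w P) (hw P hPZ).1, ?_⟩
      rw [Finset.union_insert, Finset.insert_eq_of_mem
        (Finset.mem_union_left _ (hw P hPZ).1), Finset.union_sdiff_of_subset hPS]

/-- A clique count exceeding the number of `(p + r)`-sets that meet `Z` in more than `p` points
forces an edge disjoint from `Z`. -/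
lemma exists_edge_disjoint_of_card_lt_cliqueCount {n p r : ℕ} {F : Finset (Finset (Fin n))}
    {Z : Finset (Fin n)}
    (h : #((Finset.univ.powersetCard (p + r)).filter fun S => p + 1 ≤ #(S ∩ Z)) <
      cliqueCount r (p + r) F) : ∃ E ∈ F, Disjoint E Z := by
  obtain ⟨S, hS, hSZ⟩ := Finset.exists_mem_notMem_of_card_lt_card h
  simp only [Finset.mem_filter, Finset.mem_powersetCard_univ] at hS hSZ
  have h3 : r ≤ #(S \ Z) := by
    have := Finset.card_sdiff_add_card_inter S Z
    have : ¬ p + 1 ≤ #(S ∩ Z) := fun h => hSZ ⟨hS.1, h⟩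
    omega
  obtain ⟨E, hES, hEc⟩ := Finset.exists_subset_card_eq h3
  exact ⟨E, hS.2 (Finset.mem_powersetCard.2 ⟨hES.trans Finset.sdiff_subset, hEc⟩),
    Finset.disjoint_of_subset_left hES Finset.sdiff_disjoint⟩

/-- The vertices whose degree exceeds `d`. -/
def highDegree {n : ℕ} (F : Finset (Finset (Fin n))) (d : ℕ) : Finset (Fin n) :=
  Finset.univ.filter fun v => d < degOf F {v}

/-- A hypergraph with many cliques whose edges all meet a small set has many vertices of high
degree. -/
lemma card_highDegree_of_cover {n k r s d₁ d₂ : ℕ} (hr : 0 < r) (hk : 2 ≤ k) (hkn : k ≤ n)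
    (hd : d₁ ≤ d₂) {F : Finset (Finset (Fin n))} {U : Finset (Fin n)}
    (hU : ∀ E ∈ F, ¬ Disjoint E U) (hUc : #U ≤ (k - 1) * r) (hrs : r ≤ s) (hsk : s ≤ k + r - 2)
    (hbig : ∀ p ≤ k - 2, ((k - 1) * r).choose (p + 1) * d₁ + (k - 2).choose p * d₂ ≤
      (k - 2).choose p * (n - (k - 1)).choose (r - 1))
    (hcl : cliqueCount r s (Fnka n (k - 1) r 1) < cliqueCount r s F) :
    k ≤ #(highDegree F d₁) ∨ (#(highDegree F d₁) = k - 1 ∧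
      (∀ v ∈ highDegree F d₁, d₂ < degOf F {v}) ∧ ∃ E ∈ F, Disjoint E (highDegree F d₁)) := by
  rw [or_iff_not_imp_left, not_le]
  intro hlt
  obtain ⟨p, rfl⟩ : ∃ p, s = p + r := ⟨s - r, by omega⟩
  have hp : p ≤ k - 2 := by omega
  obtain ⟨Z, hZ, -, hZc⟩ := Finset.exists_subsuperset_card_eq (n := k - 1)
    (Finset.subset_univ (highDegree F d₁)) (by omega) (by simp; omega)
  have hfirst : #(Finset.univ.filter fun x : Fin n => (x : ℕ) < k - 1) = k - 1 := by
    rw [Fin.card_filter_val_lt]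
    omega
  have hcount : #((Finset.univ.powersetCard (p + r)).filter fun S => p + 1 ≤ #(S ∩ Z)) <
      cliqueCount r (p + r) F := by
    have h1 := card_filter_inter_le_cliqueCount (n := n) (k := k - 1) (r := r) (s := p + r) hrs
    rw [Nat.add_sub_cancel, card_filter_inter_eq_of_card_eq _ _ (hfirst.trans hZc.symm)] at h1
    exact h1.trans_lt hcl
  have hZ₂ : ∀ v ∈ Z, d₂ < degOf F {v} := by
    intro v hv
    by_contra! hle
    have h1 := cliqueCount_le_of_cover (p := p) (D := d₁) hr hv hU hUc fun w hw => by
      by_contra! h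
      exact hw (hZ (Finset.mem_filter.2 ⟨Finset.mem_univ _, h⟩))
    have h2 := card_filter_inter_erase_add_le (p := p) hr hv
    have h3 := hbig p hp
    rw [hZc, show k - 1 - 1 = k - 2 by omega] at h1 h2
    have h4 := Nat.mul_le_mul_left ((k - 2).choose p) hle
    omega
  have hZeq : highDegree F d₁ = Z := hZ.antisymm fun v hv =>
    Finset.mem_filter.2 ⟨Finset.mem_univ _, hd.trans_lt (hZ₂ v hv)⟩
  rw [hZeq]
  exact ⟨hZc, hZ₂, exists_edge_disjoint_of_card_lt_cliqueCount hcount⟩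

/-- Hall's theorem for a subset of the index set. -/
lemma exists_injOn_of_hall {ι : Type*} [Fintype ι] {n : ℕ} (hn : Fintype.card ι ≤ n)
    {J : Finset ι} {t : ι → Finset (Fin n)} (h : ∀ s ⊆ J, #s ≤ #(s.biUnion t)) :
    ∃ x : ι → Fin n, Set.InjOn x J ∧ ∀ i ∈ J, x i ∈ t i := by
  classical
  obtain ⟨x, hx, hxt⟩ := (Finset.all_card_le_biUnion_card_iff_exists_injective
    fun i => if i ∈ J then t i else Finset.univ).1 (by
      intro s
      by_cases hs : s ⊆ J
      · refine (h s hs).trans (Finset.card_le_card ?_)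
        exact Finset.biUnion_mono fun i hi => by simp [hs hi]
      · obtain ⟨i, his, hiJ⟩ := Finset.not_subset.1 hs
        refine (Finset.card_le_univ s).trans (hn.trans ?_)
        have := Finset.card_le_card (Finset.subset_biUnion_of_mem
          (fun i => if i ∈ J then t i else Finset.univ) his)
        simpa [hiJ] using this)
  exact ⟨x, hx.injOn, fun i hi => by simpa [hi] using hxt i⟩

/-- A partial rainbow matching extends over the families that no small set covers. -/
lemma RainbowOn.extend {ι V : Type*} [Fintype ι] [DecidableEq ι] [DecidableEq V] {r : ℕ}
    {F : ι → Finset (Finset V)} (hF : ∀ i, ∀ E ∈ F i, #E = r) {J : Finset ι} {e : ι → Finset V}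
    (he : RainbowOn F J e)
    (h : ∀ i ∉ J, ∀ U : Finset V, #U ≤ (Fintype.card ι - 1) * r → ∃ E ∈ F i, Disjoint E U) :
    ∃ e, RainbowOn F Finset.univ e := by
  suffices ∀ T : Finset ι, ∃ e, RainbowOn F (T ∪ J) e by
    simpa [Finset.union_eq_left.2 (Finset.subset_univ J)] using this Finset.univ
  intro T
  induction T using Finset.induction_on with
  | empty => exact ⟨e, by simpa using he⟩
  | insert i T hi ih =>
    obtain ⟨e, he⟩ := ih
    rw [Finset.insert_union]
    by_cases hiJ : i ∈ T ∪ J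
    · exact ⟨e, by rwa [Finset.insert_eq_of_mem hiJ]⟩
    · have hlt : #(T ∪ J) < Fintype.card ι := Finset.card_lt_univ_of_notMem hiJ
      obtain ⟨E, hE, hd⟩ := h i (fun h => hiJ (Finset.mem_union_right _ h)) ((T ∪ J).biUnion e)
        ((he.card_biUnion_le fun i _ => hF i).trans (Nat.mul_le_mul_right _ (by omega)))
      exact ⟨_, he.insert hiJ hE fun j hj => (Finset.disjoint_biUnion_right _ _ _).1 hd j hj⟩

/-- Families with sufficiently many vertices of high degree have a rainbow matching. -/
lemma exists_rainbowOn_of_highDegree {n k r : ℕ} (hk : 2 ≤ k) (hkn : k ≤ n)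
    (h32 : k * r ^ 2 * supersetCount n r 3 ≤ supersetCount n r 2)
    {F : Fin k → Finset (Finset (Fin n))} (hF : ∀ i, ∀ E ∈ F i, #E = r) {J : Finset (Fin k)}
    {H : Fin k → Finset (Fin n)}
    (hH : ∀ i, H i = highDegree (F i) (2 * k * supersetCount n r 2))
    (hgood : ∀ i ∈ J, k ≤ #(H i) ∨ (#(H i) = k - 1 ∧
      (∀ v ∈ H i, (2 * k + r) * supersetCount n r 2 < degOf (F i) {v}) ∧
      ∃ E ∈ F i, Disjoint E (H i))) :
    ∃ e, RainbowOn F J e := by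
  have hle : ∀ i ∈ J, k - 1 ≤ #(H i) := fun i hi => by
    rcases hgood i hi with h | h <;> omega
  by_cases hall : ∀ s ⊆ J, #s ≤ #(s.biUnion H)
  · obtain ⟨x, hx, hxH⟩ := exists_injOn_of_hall (by simpa using hkn) hall
    obtain ⟨e, he, -⟩ := exists_rainbowOn_of_degree (W := ∅) h32
      ((Finset.card_le_univ J).trans (by simp)) (fun i _ => hF i) hx (by simp) fun i hi => by
        have := hxH i hi
        rw [hH] at this
        simpa using (Finset.mem_filter.1 this).2
    exact ⟨e, he⟩
  · push Not at hall
    obtain ⟨s, hsJ, hs⟩ := hall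
    have hsk : #s ≤ k := (Finset.card_le_univ s).trans (by simp)
    have hHs : ∀ i ∈ s, #(H i) ≤ #(s.biUnion H) := fun i hi =>
      Finset.card_le_card (Finset.subset_biUnion_of_mem H hi)
    obtain ⟨i₀, hi₀⟩ : s.Nonempty := Finset.card_pos.1 (by omega)
    have hsc : #s = k := by
      have h1 := hHs i₀ hi₀
      have h2 := hle i₀ (hsJ hi₀)
      omega
    obtain rfl : s = Finset.univ := Finset.eq_univ_of_card s (by simpa using hsc)
    obtain rfl : J = Finset.univ := Finset.univ_subset_iff.1 hsJ
    set B := Finset.univ.biUnion H with hB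
    have hHB : ∀ i, H i = B := fun i =>
      Finset.eq_of_subset_of_card_le (Finset.subset_biUnion_of_mem H (Finset.mem_univ i)) (by
        have := hle i (Finset.mem_univ i)
        omega)
    have hBc : #B = k - 1 := by
      have := hle i₀ hi₀
      rw [hHB] at this
      omega
    have hgood' : ∀ i, (∀ v ∈ B, (2 * k + r) * supersetCount n r 2 < degOf (F i) {v}) ∧
        ∃ E ∈ F i, Disjoint E B := fun i => by
      rcases hgood i (Finset.mem_univ i) with h | h
      · rw [hHB] at h
        omega
      · rw [hHB] at h
        exact h.2
    obtain ⟨E, hE, hEB⟩ := (hgood' i₀).2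
    have hec : #(Finset.univ.erase i₀) = k - 1 := by simp
    obtain ⟨x, hx, hxB⟩ := exists_injOn_of_hall (J := Finset.univ.erase i₀) (t := fun _ => B)
      (by simpa using hkn) (by
        intro s hs
        rcases s.eq_empty_or_nonempty with rfl | ⟨j, hj⟩
        · simp
        · calc #s ≤ k - 1 := hec ▸ Finset.card_le_card hs
            _ = #B := hBc.symm
            _ ≤ _ := Finset.card_le_card (Finset.subset_biUnion_of_mem (fun _ => B) hj))
    obtain ⟨e, he, heE⟩ := exists_rainbowOn_of_degree (W := E) h32 (by omega)
      (fun i _ => hF i) hx (fun i hi h => Finset.disjoint_left.1 hEB h (hxB i hi)) fun i hi => by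
        rw [hF i₀ E hE]
        exact (hgood' i).1 _ (hxB i hi)
    exact ⟨_, Finset.insert_erase (Finset.mem_univ i₀) ▸
      he.insert (Finset.notMem_erase _ _) hE fun j hj => (heE j hj).symm⟩

lemma mul_supersetCount_three_le {n k r : ℕ} (h : k * r ^ 3 + 3 ≤ n) :
    k * r ^ 2 * supersetCount n r 3 ≤ supersetCount n r 2 := by
  refine Nat.le_of_mul_le_mul_left ?_ (show 0 < n - 2 by omega)
  calc (n - 2) * (k * r ^ 2 * supersetCount n r 3)
      = k * r ^ 2 * ((n - 2) * supersetCount n r (2 + 1)) := by ring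
    _ = k * r ^ 2 * (r - 2) * supersetCount n r 2 := by
        rw [mul_supersetCount_succ (by omega)]; ring
    _ ≤ (n - 2) * supersetCount n r 2 := by
        refine Nat.mul_le_mul_right _ ?_
        have : k * r ^ 2 * (r - 2) ≤ k * r ^ 2 * r := Nat.mul_le_mul_left _ (by omega)
        have : k * r ^ 2 * r = k * r ^ 3 := by ring
        omega

/-- The main term of the clique count of `F^{(r)}_{n,k-1,1}` dominates the error terms. -/
lemma choose_mul_add_le_choose_mul {n k r p : ℕ} (hr : 0 < r) (hk : 2 ≤ k) (hp : p ≤ k - 2)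
    (hn : 4 * k ^ 2 * (Real.exp 1 * r) ^ k ≤ (n : ℝ)) (hkn : k ≤ n) :
    ((k - 1) * r).choose (p + 1) * (2 * k * supersetCount n r 2) +
      (k - 2).choose p * ((2 * k + r) * supersetCount n r 2) ≤
      (k - 2).choose p * (n - (k - 1)).choose (r - 1) := by
  rcases Nat.lt_or_ge r 2 with hr2 | hr2
  · simp [supersetCount, show ¬ 2 ≤ r by omega]
  set c := (k - 2).choose p with hc
  set b := supersetCount n r 2 with hb
  set C := (n - (k - 1)).choose (r - 1) with hC
  set Q := (Real.exp 1 * r) ^ (k - 1) with hQ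
  have he : (2 : ℝ) ≤ Real.exp 1 := by linarith [Real.add_one_le_exp 1]
  have hrR : (2 : ℝ) ≤ r := by exact_mod_cast hr2
  have hkR : (2 : ℝ) ≤ k := by exact_mod_cast hk
  have her : (r : ℝ) ≤ Real.exp 1 * r := by nlinarith
  have hQr : (r : ℝ) ≤ Q := her.trans (le_self_pow₀ (by linarith) (by omega))
  have hchoose : (((k - 1) * r).choose (p + 1) : ℝ) ≤ Q * (k * c) := by
    have h1 := choose_mul_le_exp_mul_pow_mul_choose (r := r) (show p + 1 ≤ k - 1 by omega)
    have h2 : (Real.exp 1 * r) ^ (p + 1) ≤ Q := pow_le_pow_right₀ (by linarith) (by omega)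
    have h3 : (k - 1).choose (p + 1) ≤ k * c := by
      have := Nat.add_one_mul_choose_eq (k - 2) p
      rw [show k - 2 + 1 = k - 1 by omega] at this
      calc (k - 1).choose (p + 1) ≤ (k - 1).choose (p + 1) * (p + 1) :=
            Nat.le_mul_of_pos_right _ (by omega)
        _ = (k - 1) * c := this.symm
        _ ≤ k * c := Nat.mul_le_mul_right _ (by omega)
    refine h1.trans ?_
    have h3' : ((k - 1).choose (p + 1) : ℝ) ≤ k * c := by exact_mod_cast h3
    gcongr
  have hA : (n - 1) * b = (r - 1) * (n - 1).choose (r - 1) := by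
    have := mul_supersetCount_succ (n := n) (r := r) (j := 1) (by omega)
    rw [supersetCount, if_pos (by omega)] at this
    simpa [hb, supersetCount, hr2, show 1 ≤ r by omega] using this
  have hAC : (n - 1).choose (r - 1) ≤ C + (k - 2) * b := by
    have := choose_le_choose_add_mul_supersetCount (n := n) hr (k - 2) (by omega)
    rwa [show k - 2 + 1 = k - 1 by omega] at this
  have hnQ : 4 * k ^ 2 * (2 * r * Q) ≤ (n : ℝ) := by
    refine le_trans ?_ hn
    rw [show k = k - 1 + 1 by omega, pow_succ (Real.exp 1 * r), show k - 1 + 1 = k by omega, ← hQ]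
    have : 2 * (r : ℝ) * Q ≤ Q * (Real.exp 1 * r) := by
      rw [mul_comm Q]
      gcongr
    gcongr
  have hmain : b * (2 * k ^ 2 * Q + 3 * k + r) ≤ ((n - 1).choose (r - 1) : ℝ) := by
    have hA' : ((n : ℝ) - 1) * b = ((r : ℝ) - 1) * (n - 1).choose (r - 1) := by
      have := congrArg (Nat.cast : ℕ → ℝ) hA
      push_cast [Nat.cast_sub (show 1 ≤ n by omega), Nat.cast_sub (show 1 ≤ r by omega)] at this
      exact this
    have hk2 : (k : ℝ) ≤ k ^ 2 := by nlinarith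
    have hb0 : (0 : ℝ) ≤ b := Nat.cast_nonneg _
    have h4 : (k : ℝ) ≤ k ^ 2 * Q := by nlinarith
    have h5 : (r : ℝ) ≤ k ^ 2 * Q := by nlinarith
    have h6 : ((r : ℝ) - 1) * (2 * k ^ 2 * Q + 3 * k + r) ≤ n - 1 := by
      have h7 : 2 * k ^ 2 * Q + 3 * k + r ≤ 6 * (k ^ 2 * Q) := by linarith
      have h8 : (2 : ℝ) ≤ k ^ 2 * Q := by linarith
      nlinarith
    have h9 : ((r : ℝ) - 1) * (b * (2 * k ^ 2 * Q + 3 * k + r)) ≤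
        ((r : ℝ) - 1) * (n - 1).choose (r - 1) := by
      rw [← hA']
      nlinarith
    exact le_of_mul_le_mul_left h9 (by linarith)
  have hCb : (b : ℝ) * (2 * k ^ 2 * Q + 2 * k + r) ≤ C := by
    have h1 : ((n - 1).choose (r - 1) : ℝ) ≤ C + ((k - 2 : ℕ) : ℝ) * b := by exact_mod_cast hAC
    have h2 : ((k - 2 : ℕ) : ℝ) * b ≤ k * b := by
      gcongr
      omega
    nlinarith
  have hfin : (((k - 1) * r).choose (p + 1) : ℝ) * (2 * k * b) + c * ((2 * k + r) * b) ≤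
      c * C :=
    calc (((k - 1) * r).choose (p + 1) : ℝ) * (2 * k * b) + c * ((2 * k + r) * b)
        ≤ Q * (k * c) * (2 * k * b) + c * ((2 * k + r) * b) := by gcongr
      _ = c * (b * (2 * k ^ 2 * Q + 2 * k + r)) := by ring
      _ ≤ c * C := by gcongr
  exact_mod_cast hfin

lemma cliqueCount_self {n r : ℕ} {F : Finset (Finset (Fin n))} (hF : ∀ E ∈ F, #E = r) :
    cliqueCount r r F = #F := by
  unfold cliqueCount
  congr 1
  ext S
  simp only [Finset.mem_filter, Finset.mem_powersetCard_univ]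
  constructor
  · rintro ⟨rfl, h⟩
    exact h (Finset.mem_powersetCard.2 ⟨Finset.Subset.rfl, rfl⟩)
  · intro hS
    refine ⟨hF S hS, ?_⟩
    rw [← hF S hS, Finset.powersetCard_self]
    simpa using hS

lemma choose_le_cliqueCount_Fnka_one {n r : ℕ} (hn : 0 < n) (hr : 0 < r) :
    (n - 1).choose (r - 1) ≤ cliqueCount r r (Fnka n 1 r 1) := by
  have h1 := card_filter_inter_le_cliqueCount (n := n) (k := 1) (le_refl r)
  have hv : (⟨0, hn⟩ : Fin n) ∈ Finset.univ.filter fun x : Fin n => (x : ℕ) < 1 := by simp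
  have h2 := card_filter_inter_erase_add_le (p := 0) hr hv
  have hc : #(Finset.univ.filter fun x : Fin n => (x : ℕ) < 1) = 1 := by
    rw [Fin.card_filter_val_lt]
    omega
  rw [hc] at h2
  simp only [Nat.sub_self, zero_add, Nat.choose_zero_right, one_mul] at h1 h2
  exact (Nat.le_add_left _ _).trans (h2.trans h1)

/-- Lemma 4.2 (base case for the rainbow matching theorem). -/
theorem rainbow_matching_base_case {n k r : ℕ}
    (hn0 : 0 < n) (hk0 : 0 < k) (hr0 : 0 < r)
    (hn : 4 * k ^ 2 * (Real.exp 1 * r) ^ k ≤ (n : ℝ))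
    (F : Fin k → Finset (Finset (Fin n)))
    (hunif : ∀ i, ∀ E ∈ F i, E.card = r)
    (hcl : ∀ i, ∃ s, r ≤ s ∧ s ≤ k + r - 2 ∧
      cliqueCount r s (Fnka n (k - 1) r 1) < cliqueCount r s (F i)) :
    ∃ e : Fin k → Finset (Fin n), (∀ i, e i ∈ F i) ∧
      ∀ i j, i ≠ j → Disjoint (e i) (e j) := by
  have he : (2 : ℝ) ≤ Real.exp 1 := by linarith [Real.add_one_le_exp 1]
  have hrR : (1 : ℝ) ≤ r := by exact_mod_cast hr0
  have her : (r : ℝ) ≤ Real.exp 1 * r := by nlinarith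
  have hkR : (1 : ℝ) ≤ k := by exact_mod_cast hk0
  have hkk : (k : ℝ) ≤ k ^ 2 := by nlinarith
  obtain rfl | rfl | hk3 : k = 1 ∨ k = 2 ∨ 3 ≤ k := by omega
  · obtain ⟨s, h1, h2, -⟩ := hcl 0
    omega
  · have hrn : 2 * r ≤ n := by
      have h1 : (r : ℝ) ^ 2 ≤ (Real.exp 1 * r) ^ 2 := by gcongr
      have h2 : (2 * r : ℝ) ≤ n := by
        push_cast at hn
        nlinarith
      exact_mod_cast h2
    have hcard : ∀ i, (n - 1).choose (r - 1) < #(F i) := by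
      intro i
      obtain ⟨s, h1, h2, h3⟩ := hcl i
      obtain rfl : s = r := by omega
      rw [cliqueCount_self (hunif i)] at h3
      exact (choose_le_cliqueCount_Fnka_one hn0 hr0).trans_lt h3
    obtain ⟨A, hA, B, hB, hAB⟩ := exists_disjoint_of_choose_lt_card hr0 hrn (hunif 0) (hunif 1)
      (hcard 0) (hcard 1)
    refine ⟨![A, B], ?_, ?_⟩
    · intro i
      fin_cases i
      · exact hA
      · exact hB
    · intro i j hij
      fin_cases i <;> fin_cases j
      · exact absurd rfl hij
      · exact hAB
      · exact hAB.symm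
      · exact absurd rfl hij
  · have hn3 : k * r ^ 3 + 3 ≤ n := by
      have h1 : (r : ℝ) ^ 3 ≤ (Real.exp 1 * r) ^ k :=
        (pow_le_pow_right₀ hrR hk3).trans (by gcongr)
      have h2 : (1 : ℝ) ≤ r ^ 3 := one_le_pow₀ hrR
      have h3 : (k : ℝ) * r ^ 3 ≤ k ^ 2 * (Real.exp 1 * r) ^ k := by gcongr
      have h4 : (1 : ℝ) ≤ k * r ^ 3 := by nlinarith
      have h5 : (k * r ^ 3 + 3 : ℝ) ≤ n := by linarith
      exact_mod_cast h5
    have hkn : k ≤ n := by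
      have : k * 1 ≤ k * r ^ 3 := Nat.mul_le_mul_left _ (Nat.one_le_pow _ _ hr0)
      omega
    have h32 := mul_supersetCount_three_le hn3
    let H : Fin k → Finset (Fin n) := fun i => highDegree (F i) (2 * k * supersetCount n r 2)
    let J : Finset (Fin k) := {i | k ≤ #(H i) ∨ (#(H i) = k - 1 ∧
      (∀ v ∈ H i, (2 * k + r) * supersetCount n r 2 < degOf (F i) {v}) ∧
      ∃ E ∈ F i, Disjoint E (H i))}
    obtain ⟨e, he⟩ := exists_rainbowOn_of_highDegree (J := J) (H := H) (by omega) hkn h32 hunif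
      (fun _ => rfl) fun i hi => (Finset.mem_filter.1 hi).2
    obtain ⟨e, he⟩ := he.extend hunif (by
      intro i hi U hU
      rw [Fintype.card_fin] at hU
      by_contra! hcover
      obtain ⟨s, hrs, hsk, hs⟩ := hcl i
      refine hi (Finset.mem_filter.2 ⟨Finset.mem_univ i, ?_⟩)
      exact card_highDegree_of_cover hr0 (by omega) hkn (Nat.mul_le_mul_right _ (by omega)) hcover
        hU hrs hsk (fun p hp => choose_mul_add_le_choose_mul hr0 (by omega) hp hn hkn) hs)
    exact ⟨e, fun i => he.1 i (Finset.mem_univ i), fun i j hij =>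
      he.2 i (Finset.mem_univ i) j (Finset.mem_univ j) hij⟩
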